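/- arXiv:2104.05377 — 2 statements merged into one kernel-verified Lean document; each statement's English description precedes it below -/
import Mathlib

section
/- Let G = S³ (the group of unit quaternions) act freely on a finitistic space X whose orbit space X/G satisfies H*(X/G; R) ≅ R[a]/⟨a^{n+1}⟩ with deg a = 4 (R = ℤ or ℤ/2). Then, with coefficients in R: H^i(X) ≅ H^i(X/G) for i = 0, 1, 2; H^{4i+1}(X) = H^{4i+2}(X) = 0 for all i ≥ 0; and H^j(X) = 0 for all j > 4n+3. -/
/-!
Common abstract framework: finitistic spaces, free actions, orbit spaces, and an
abstract "Čech cohomology Gysin package" for an oriented sphere bundle.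
-/

/-- A topological space is **finitistic** if every open cover admits an open refinement of
finite order (i.e. a finite-dimensional open refinement). -/
def Finitistic (X : Type*) [TopologicalSpace X] : Prop :=
  ∀ U : Set (Set X), (∀ u ∈ U, IsOpen u) → ⋃₀ U = Set.univ →
    ∃ V : Set (Set X), (∀ v ∈ V, IsOpen v) ∧ ⋃₀ V = Set.univ ∧
      (∀ v ∈ V, ∃ u ∈ U, v ⊆ u) ∧
      ∃ n : ℕ, ∀ x : X, {v ∈ V | x ∈ v}.Finite ∧ {v ∈ V | x ∈ v}.ncard ≤ n

/-- The compact Lie group `S³` of unit quaternions. -/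
abbrev UnitQuaternions : Type := Metric.sphere (0 : Quaternion ℝ) 1

/-- An action of `G` on `X` is **free** if `g • x = x` for some `x` implies `g = 1`. -/
def IsFreeSMul (G X : Type*) [Group G] [MulAction G X] : Prop :=
  ∀ (g : G) (x : X), g • x = x → g = 1

/-- The orbit space `X/G` of an action, with the quotient topology. -/
abbrev OrbitSpace (G X : Type*) [Group G] [MulAction G X] : Type _ :=
  Quotient (MulAction.orbitRel G X)

/-- The orbit map `π : X → X/G`. -/
abbrev orbitMap (G X : Type*) [Group G] [MulAction G X] : X → OrbitSpace G X :=
  Quotient.mk (MulAction.orbitRel G X)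

/-- An abstract **Čech cohomology Gysin package** for an oriented `d`-sphere bundle
`π : E → B`, with coefficients in a commutative ring `R`.  It records the (ℤ-graded,
vanishing in negative degrees) Čech cohomology rings of `E` and of `B`, the induced ring
homomorphism `π*`, the Gysin homomorphism `ρ` of degree `-d`, the Euler class
`u ∈ H^{d+1}(B)`, and the exactness of the Gysin sequence
`⋯ → H^i(E) →^ρ H^{i-d}(B) →^{∪u} H^{i+1}(B) →^{π*} H^{i+1}(E) → ⋯`. -/
structure GysinPackage (R : Type) [CommRing R] (d : ℕ)
    {E B : Type} [TopologicalSpace E] [TopologicalSpace B] (π : E → B) : Type 1 where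
  /-- the total Čech cohomology ring `H^*(E; R)` -/
  AE : Type
  /-- the total Čech cohomology ring `H^*(B; R)` -/
  AB : Type
  [ringE : Ring AE]
  [ringB : Ring AB]
  [algE : Algebra R AE]
  [algB : Algebra R AB]
  /-- the grading `H^i(E; R)` -/
  hE : ℤ → Submodule R AE
  /-- the grading `H^i(B; R)` -/
  hB : ℤ → Submodule R AB
  [gradedE : GradedRing hE]
  [gradedB : GradedRing hB]
  negE : ∀ i : ℤ, i < 0 → hE i = ⊥
  negB : ∀ i : ℤ, i < 0 → hB i = ⊥
  /-- the induced homomorphism `π* : H^*(B) → H^*(E)` -/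
  pullback : AB →+* AE
  pullback_algebraMap : ∀ r : R, pullback (algebraMap R AB r) = algebraMap R AE r
  pullback_mem : ∀ i : ℤ, ∀ x ∈ hB i, pullback x ∈ hE i
  /-- the Gysin homomorphism `ρ : H^*(E) → H^{*-d}(B)` -/
  gysin : AE →ₗ[R] AB
  gysin_mem : ∀ i : ℤ, ∀ x ∈ hE i, gysin x ∈ hB (i - d)
  /-- the Euler class `u ∈ H^{d+1}(B)` of the oriented `d`-sphere bundle -/
  euler : AB
  euler_mem : euler ∈ hB ((d : ℤ) + 1)
  /-- exactness of the Gysin sequence at `H^i(B)`: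
  `H^{i-d-1}(B) →^{∪u} H^i(B) →^{π*} H^i(E)` -/
  exact_at_base : ∀ i : ℤ, ∀ y ∈ hB i,
    (pullback y = 0 ↔ ∃ z ∈ hB (i - ((d : ℤ) + 1)), z * euler = y)
  /-- exactness of the Gysin sequence at `H^i(E)`:
  `H^i(B) →^{π*} H^i(E) →^ρ H^{i-d}(B)` -/
  exact_at_total : ∀ i : ℤ, ∀ x ∈ hE i,
    (gysin x = 0 ↔ ∃ y ∈ hB i, pullback y = x)
  /-- exactness of the Gysin sequence at `H^i(B)` (cup-product position):
  `H^{i+d}(E) →^ρ H^i(B) →^{∪u} H^{i+d+1}(B)` -/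
  exact_at_cup : ∀ i : ℤ, ∀ y ∈ hB i,
    (y * euler = 0 ↔ ∃ x ∈ hE (i + d), gysin x = y)

attribute [instance] GysinPackage.ringE GysinPackage.ringB GysinPackage.algE
  GysinPackage.algB GysinPackage.gradedE GysinPackage.gradedB

/-- The graded ring `h` is (isomorphic to) the truncated polynomial ring
`R[a]/⟨a^{n+1}⟩` on a generator `a` of degree `k`: each `H^{ki}` (`0 ≤ i ≤ n`) is a free
`R`-module of rank one on `a^i`, all other graded pieces vanish, and `a^{n+1} = 0`. -/
def IsTruncPolyCohomology {R A : Type} [CommRing R] [Ring A] [Algebra R A]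
    (h : ℤ → Submodule R A) (n k : ℕ) (a : A) : Prop :=
  a ∈ h (k : ℤ) ∧ a ^ (n + 1) = 0 ∧
    (∀ i : ℕ, i ≤ n →
      h ((k : ℤ) * i) = Submodule.span R {a ^ i} ∧ ∀ r : R, r • a ^ i = 0 → r = 0) ∧
    ∀ j : ℤ, (∀ i : ℕ, i ≤ n → j ≠ (k : ℤ) * i) → h j = ⊥

/-- The graded ring `h` is (isomorphic to) `R[a, b]/⟨a^{n+1}, b²⟩` with `deg a = k`,
`deg b = l` — the cohomology ring of a product `sphere × projective space`:
the graded pieces in degrees `k·i` resp. `k·i + l` (`0 ≤ i ≤ n`) are free of rank one on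
`a^i` resp. `a^i * b`, all other pieces vanish, with relations `a^{n+1} = 0`, `b² = 0`,
`a*b = b*a`. -/
def IsProductCohomology {R A : Type} [CommRing R] [Ring A] [Algebra R A]
    (h : ℤ → Submodule R A) (n k l : ℕ) (a b : A) : Prop :=
  a ∈ h (k : ℤ) ∧ b ∈ h (l : ℤ) ∧ a ^ (n + 1) = 0 ∧ b * b = 0 ∧ a * b = b * a ∧
    (∀ i : ℕ, i ≤ n →
      (h ((k : ℤ) * i) = Submodule.span R {a ^ i} ∧ ∀ r : R, r • a ^ i = 0 → r = 0) ∧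
      (h ((k : ℤ) * i + l) = Submodule.span R {a ^ i * b} ∧
        ∀ r : R, r • (a ^ i * b) = 0 → r = 0)) ∧
    ∀ j : ℤ, (∀ i : ℕ, i ≤ n → j ≠ (k : ℤ) * i ∧ j ≠ (k : ℤ) * i + l) → h j = ⊥

/-- If `G = S³` acts freely on a finitistic space `X` whose orbit space has
the Čech cohomology ring `R[a]/⟨a^{n+1}⟩` of `ℍP^n` (`R = ℤ` or `ℤ/2`), then
`H^i(X) ≅ H^i(X/G)` for `i = 0, 1, 2`, `H^{4i+1}(X) = H^{4i+2}(X) = 0` for all `i ≥ 0`, and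
`H^j(X) = 0` for all `j > 4n+3`. -/
theorem low_degrees_and_vanishing
    (R : Type) [CommRing R] (hR : Nonempty (R ≃+* ℤ) ∨ Nonempty (R ≃+* ZMod 2))
    (X : Type) [TopologicalSpace X] (hfin : Finitistic X)
    [MulAction UnitQuaternions X] [ContinuousSMul UnitQuaternions X]
    (hfree : IsFreeSMul UnitQuaternions X)
    (n : ℕ) (P : GysinPackage R 3 (orbitMap UnitQuaternions X))
    (a : P.AB) (ha : IsTruncPolyCohomology P.hB n 4 a) :
    (∀ i : ℤ, 0 ≤ i → i ≤ 2 → Nonempty ((P.hE i) ≃ₗ[R] (P.hB i))) ∧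
      (∀ i : ℕ, P.hE (4 * (i : ℤ) + 1) = ⊥ ∧ P.hE (4 * (i : ℤ) + 2) = ⊥) ∧
      (∀ j : ℤ, 4 * (n : ℤ) + 3 < j → P.hE j = ⊥) := by
  obtain ⟨-, -, -, hz⟩ := ha
  have surj : ∀ i : ℤ, P.hB (i - 3) = ⊥ → ∀ x ∈ P.hE i, ∃ y ∈ P.hB i, P.pullback y = x := by
    intro i h x hx
    refine (P.exact_at_total i x hx).1 ?_
    have h1 := P.gysin_mem i x hx
    have h2 : P.gysin x ∈ P.hB (i - 3) := by exact_mod_cast h1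
    rw [h] at h2
    exact (Submodule.mem_bot R).1 h2
  have key : ∀ i : ℤ, P.hB (i - 3) = ⊥ → P.hB i = ⊥ → P.hE i = ⊥ := by
    intro i h h'
    rw [eq_bot_iff]
    intro x hx
    obtain ⟨y, hy, rfl⟩ := surj i h x hx
    rw [h'] at hy
    rw [(Submodule.mem_bot R).1 hy, map_zero]
    exact Submodule.zero_mem _
  refine ⟨?_, ?_, ?_⟩
  · intro i h0 h2
    let f : P.hB i →ₗ[R] P.hE i :=
      { toFun := fun y => ⟨P.pullback y, P.pullback_mem i y y.2⟩
        map_add' := fun y z => by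
          apply Subtype.ext
          simp
        map_smul' := fun r y => by
          apply Subtype.ext
          simp [Algebra.smul_def, P.pullback_algebraMap] }
    refine ⟨(LinearEquiv.ofBijective f ⟨?_, ?_⟩).symm⟩
    · rw [injective_iff_map_eq_zero]
      intro y hy
      have hy' : P.pullback y = 0 := congrArg Subtype.val hy
      obtain ⟨z, hz1, hz2⟩ := (P.exact_at_base i y y.2).1 hy'
      rw [P.negB _ (by push_cast; omega)] at hz1
      apply Subtype.ext
      rw [← hz2, (Submodule.mem_bot R).1 hz1, zero_mul]
      rfl
    · intro x
      obtain ⟨y, hy, h⟩ := surj i (P.negB _ (by omega)) x x.2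
      exact ⟨⟨y, hy⟩, Subtype.ext h⟩
  · intro i
    constructor
    · apply key <;> apply hz <;> intro k hk <;> push_cast <;> omega
    · apply key <;> apply hz <;> intro k hk <;> push_cast <;> omega
  · intro j hj
    apply key <;> apply hz <;> intro k hk <;> push_cast <;> omega
end

section
/- Let G = S¹ (the circle group) act freely on a finitistic space X whose orbit space X/G has mod p Čech cohomology ring H*(X/G; ℤ_p) ≅ ℤ_p[a]/⟨a^{n+1}⟩ with deg a = 2, where p is a prime. If the map π* : H²(X/G; ℤ_p) → H²(X; ℤ_p) induced by the orbit map π : X → X/G is trivial, then X has the mod p Čech cohomology of the sphere S^{2n+1}: H^i(X; ℤ_p) ≅ ℤ_p for i = 0 and i = 2n+1, and H^i(X; ℤ_p) = 0 otherwise. -/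
/-- A submodule spanned by a nonzero vector over a field is a line. -/
theorem nonempty_equiv_of_span {K V : Type} [Field K] [AddCommGroup V] [Module K V]
    (S : Submodule K V) (x : V) (hx : x ≠ 0) (hxS : x ∈ S)
    (h : ∀ y ∈ S, ∃ r : K, y = r • x) : Nonempty (S ≃ₗ[K] K) := by
  have hS : S = Submodule.span K {x} := by
    apply le_antisymm
    · intro y hy
      obtain ⟨r, rfl⟩ := h y hy
      exact Submodule.smul_mem _ _ (Submodule.mem_span_singleton_self x)
    · rw [Submodule.span_singleton_le_iff_mem]
      exact hxS
  subst hS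
  exact ⟨(LinearEquiv.toSpanNonzeroSingleton K V x hx).symm⟩

/-- If `G = S¹` acts freely on a finitistic space `X` whose orbit space is a
mod `p` cohomology `ℂP^n` (`H^*(X/G; ℤ_p) ≅ ℤ_p[a]/⟨a^{n+1}⟩`, `deg a = 2`, `p` prime), and
the induced map `π* : H²(X/G; ℤ_p) → H²(X; ℤ_p)` is trivial, then `X` is a mod `p` cohomology
sphere `S^{2n+1}`: `H^i(X; ℤ_p) ≅ ℤ_p` for `i = 0, 2n+1`, and `0` otherwise. -/
theorem circle_action_cohomology_sphere_of_pullback_trivial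
    (p : ℕ) [Fact p.Prime]
    (X : Type) [TopologicalSpace X] (hfin : Finitistic X)
    [MulAction Circle X] [ContinuousSMul Circle X]
    (hfree : IsFreeSMul Circle X)
    (n : ℕ) (P : GysinPackage (ZMod p) 1 (orbitMap Circle X))
    (a : P.AB) (ha : IsTruncPolyCohomology P.hB n 2 a)
    (hpi : ∀ y ∈ P.hB 2, P.pullback y = 0) :
    ∀ i : ℤ, ((i = 0 ∨ i = 2 * (n : ℤ) + 1) → Nonempty ((P.hE i) ≃ₗ[ZMod p] ZMod p)) ∧
      (¬(i = 0 ∨ i = 2 * (n : ℤ) + 1) → P.hE i = ⊥) := by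
  obtain ⟨ha2, hnil, hfr, hvan⟩ := ha
  have hrep : ∀ j : ℕ, j ≤ n → ∀ y ∈ P.hB (2 * (j : ℤ)), ∃ r : ZMod p, y = r • a ^ j := by
    intro j hj y hy
    have h1 := (hfr j hj).1
    push_cast at h1
    rw [h1, Submodule.mem_span_singleton] at hy
    obtain ⟨r, hr⟩ := hy
    exact ⟨r, hr.symm⟩
  have hmem : ∀ j : ℕ, j ≤ n → a ^ j ∈ P.hB (2 * (j : ℤ)) := by
    intro j hj
    have h1 := (hfr j hj).1
    push_cast at h1
    rw [h1]
    exact Submodule.mem_span_singleton_self _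
  have hne : ∀ j : ℕ, j ≤ n → a ^ j ≠ 0 := by
    intro j hj h0
    exact one_ne_zero ((hfr j hj).2 1 (by rw [h0, smul_zero]))
  have hzero : ∀ j : ℤ, (∀ i : ℕ, i ≤ n → j ≠ 2 * (i : ℤ)) → ∀ y ∈ P.hB j, y = 0 := by
    intro j hj y hy
    have h1 := hvan j (by push_cast; exact hj)
    rw [h1] at hy
    exact (Submodule.mem_bot _).1 hy
  -- the Euler class is a nonzero multiple of the generator
  have heul : ∃ c : ZMod p, c ≠ 0 ∧ P.euler = c • a := by
    rcases Nat.eq_zero_or_pos n with hn | hn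
    · refine ⟨1, one_ne_zero, ?_⟩
      have hE := P.euler_mem
      have h1 : P.euler = 0 := by
        refine hzero _ ?_ _ hE
        intro i hi
        push_cast
        omega
      have h2 : a = 0 := by
        subst hn
        simpa using hnil
      rw [h1, h2, smul_zero]
    · have ha2' : a ∈ P.hB 2 := by simpa using ha2
      obtain ⟨z, hz, hza⟩ := (P.exact_at_base 2 a ha2').1 (hpi a ha2')
      have hz0 : z ∈ P.hB (2 * ((0 : ℕ) : ℤ)) := by
        have h3 : (2 : ℤ) - (((1 : ℕ) : ℤ) + 1) = 2 * ((0 : ℕ) : ℤ) := by norm_num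
        rwa [h3] at hz
      obtain ⟨r, hr⟩ := hrep 0 (Nat.zero_le _) z hz0
      rw [hr, pow_zero, smul_mul_assoc, one_mul] at hza
      have hr0 : r ≠ 0 := by
        intro h0
        rw [h0, zero_smul] at hza
        exact hne 1 hn (by rw [pow_one, ← hza])
      refine ⟨r⁻¹, inv_ne_zero hr0, ?_⟩
      rw [← hza, smul_smul, inv_mul_cancel₀ hr0, one_smul]
  obtain ⟨c, hc, hec⟩ := heul
  have hpull : ∀ i : ℤ, i ≠ 0 → ∀ y ∈ P.hB i, P.pullback y = 0 := by
    intro i hi y hy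
    by_cases hex : ∃ j : ℕ, j ≤ n ∧ i = 2 * (j : ℤ)
    · obtain ⟨j, hj, rfl⟩ := hex
      obtain ⟨r, rfl⟩ := hrep j hj y hy
      obtain ⟨k, rfl⟩ : ∃ k, j = k + 1 := ⟨j - 1, by omega⟩
      rw [P.exact_at_base _ _ hy]
      refine ⟨(r * c⁻¹) • a ^ k, ?_, ?_⟩
      · have h3 : 2 * ((k + 1 : ℕ) : ℤ) - (((1 : ℕ) : ℤ) + 1) = 2 * (k : ℤ) := by
          push_cast; ring
        rw [h3]
        exact Submodule.smul_mem _ _ (hmem k (by omega))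
      · rw [hec, smul_mul_assoc, mul_smul_comm, smul_smul, ← pow_succ, mul_assoc,
          inv_mul_cancel₀ hc, mul_one]
    · push Not at hex
      rw [hzero i hex y hy, map_zero]
  have hcup : ∀ i : ℤ, i ≠ 2 * (n : ℤ) → ∀ y ∈ P.hB i, y * P.euler = 0 → y = 0 := by
    intro i hi y hy h0
    by_cases hex : ∃ j : ℕ, j ≤ n ∧ i = 2 * (j : ℤ)
    · obtain ⟨j, hj, rfl⟩ := hex
      obtain ⟨r, rfl⟩ := hrep j hj y hy
      rw [hec, smul_mul_assoc, mul_smul_comm, smul_smul, ← pow_succ] at h0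
      have h4 := (hfr (j + 1) (by omega)).2 _ h0
      rcases mul_eq_zero.1 h4 with h5 | h5
      · rw [h5, zero_smul]
      · exact absurd h5 hc
    · push Not at hex
      exact hzero i hex y hy
  intro i
  refine ⟨?_, ?_⟩
  · rintro (rfl | rfl)
    · refine nonempty_equiv_of_span _ (1 : P.AE) ?_ SetLike.GradedOne.one_mem ?_
      · intro h1
        have h2 : P.pullback 1 = 0 := by rw [map_one, h1]
        obtain ⟨z, hz, hz1⟩ := (P.exact_at_base 0 1 SetLike.GradedOne.one_mem).1 h2
        have hz0 : z = 0 := by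
          rw [P.negB _ (by norm_num)] at hz
          exact (Submodule.mem_bot _).1 hz
        rw [hz0, zero_mul] at hz1
        exact hne 0 (Nat.zero_le _) (by rw [pow_zero, ← hz1])
      · intro x hx
        have hg : P.gysin x = 0 := by
          have h1 := P.gysin_mem 0 x hx
          rw [P.negB _ (by norm_num)] at h1
          exact (Submodule.mem_bot _).1 h1
        obtain ⟨y, hy, rfl⟩ := (P.exact_at_total 0 x hx).1 hg
        obtain ⟨r, rfl⟩ := hrep 0 (Nat.zero_le _) y (by simpa using hy)
        refine ⟨r, ?_⟩
        rw [pow_zero, ← Algebra.algebraMap_eq_smul_one, P.pullback_algebraMap,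
          Algebra.algebraMap_eq_smul_one]
    · have hcn : a ^ n * P.euler = 0 := by
        rw [hec, mul_smul_comm, ← pow_succ, hnil, smul_zero]
      obtain ⟨x₀, hx₀, hgx⟩ := (P.exact_at_cup _ _ (hmem n le_rfl)).1 hcn
      rw [Nat.cast_one] at hx₀
      refine nonempty_equiv_of_span _ x₀ ?_ hx₀ ?_
      · intro h0
        rw [h0, map_zero] at hgx
        exact hne n le_rfl hgx.symm
      · intro x hx
        have hg := P.gysin_mem _ x hx
        rw [Nat.cast_one, add_sub_cancel_right] at hg
        obtain ⟨r, hr⟩ := hrep n le_rfl _ hg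
        refine ⟨r, ?_⟩
        have hd : x - r • x₀ ∈ P.hE (2 * (n : ℤ) + 1) :=
          Submodule.sub_mem _ hx (Submodule.smul_mem _ _ hx₀)
        have hgd : P.gysin (x - r • x₀) = 0 := by
          rw [map_sub, map_smul, hr, hgx, sub_self]
        obtain ⟨y, hy, hyx⟩ := (P.exact_at_total _ _ hd).1 hgd
        rw [hpull _ (by omega) y hy] at hyx
        exact sub_eq_zero.1 hyx.symm
  · intro hi
    push Not at hi
    rw [Submodule.eq_bot_iff]
    intro x hx
    have hgm := P.gysin_mem i x hx
    have hge : P.gysin x * P.euler = 0 := by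
      rw [P.exact_at_cup _ _ hgm]
      exact ⟨x, by rwa [sub_add_cancel], rfl⟩
    have hg : P.gysin x = 0 := by
      refine hcup _ ?_ _ hgm hge
      have := hi.2
      push_cast
      omega
    obtain ⟨y, hy, rfl⟩ := (P.exact_at_total i x hx).1 hg
    exact hpull i hi.1 y hy
end
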